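/- arXiv:math/9503222 — 7 statements merged into one kernel-verified Lean document; each statement's English description precedes it below -/
import Mathlib

section
/- In the annihilation game on a finite acyclic directed graph G = (V,E) with Sprague–Grundy function g, a position S ⊆ V is a P-position (the player about to move loses) if and only if the bitwise XOR of g(v) over all v ∈ S equals 0. Thus on acyclic digraphs annihilation does not change the classical winning criterion. -/
/-- The minimum excludant of a set of natural numbers. -/
noncomputable def mex (S : Set ℕ) : ℕ := sInf {n | n ∉ S}

/-- A move in the annihilation game on the digraph `E`: choose an occupied vertex
`v ∈ S` and an edge `(v,w)`; if `w` is unoccupied the token moves there, and if `w`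
is occupied both tokens are annihilated. -/
def AnnMove {V : Type*} [DecidableEq V] (E : V → V → Prop) (S T : Finset V) : Prop :=
  ∃ v ∈ S, ∃ w, E v w ∧
    ((w ∉ S ∧ T = insert w (S.erase v)) ∨ (w ∈ S ∧ T = (S.erase v).erase w))

theorem mex_notMem {S : Set ℕ} (hS : S.Finite) : mex S ∉ S :=
  Nat.sInf_mem (s := {n | n ∉ S}) hS.infinite_compl.nonempty

theorem mem_of_lt_mex {S : Set ℕ} {m : ℕ} (hm : m < mex S) : m ∈ S := by
  simpa using Nat.notMem_of_lt_sInf hm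

section XorSum

variable {V : Type*} [DecidableEq V] (g : V → ℕ)

/-- The bitwise XOR of `g v` over `v ∈ S`. -/
def xorSum (S : Finset V) : ℕ := S.fold (fun a b : ℕ => a ^^^ b) 0 g

theorem xorSum_insert {S : Finset V} {v : V} (hv : v ∉ S) :
    xorSum g (insert v S) = g v ^^^ xorSum g S :=
  Finset.fold_insert (op := fun a b : ℕ => a ^^^ b) hv

theorem xorSum_erase {S : Finset V} {v : V} (hv : v ∈ S) :
    xorSum g (S.erase v) = g v ^^^ xorSum g S := by
  conv_rhs => rw [← Finset.insert_erase hv, xorSum_insert g (Finset.notMem_erase v S)]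
  rw [← Nat.xor_assoc, Nat.xor_self, Nat.zero_xor]

theorem exists_testBit_of_testBit_xorSum {i : ℕ} (S : Finset V)
    (h : (xorSum g S).testBit i = true) : ∃ v ∈ S, (g v).testBit i = true := by
  induction S using Finset.induction_on with
  | empty => simp [xorSum] at h
  | insert a s ha ih =>
    rw [xorSum_insert g ha, Nat.testBit_xor] at h
    by_cases hb : (g a).testBit i = true
    · exact ⟨a, Finset.mem_insert_self a s, hb⟩
    · obtain ⟨v, hv, hvi⟩ := ih (by simpa [hb] using h)
      exact ⟨v, Finset.mem_insert_of_mem hv, hvi⟩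

theorem exists_xor_xorSum_lt {S : Finset V} (h : xorSum g S ≠ 0) :
    ∃ v ∈ S, g v ^^^ xorSum g S < g v := by
  obtain ⟨i, hi, hmax⟩ := Nat.exists_most_significant_bit h
  obtain ⟨v, hv, hvi⟩ := exists_testBit_of_testBit_xorSum g S hi
  refine ⟨v, hv, Nat.lt_of_testBit i ?_ hvi fun j hj => ?_⟩
  · simp [Nat.testBit_xor, hi, hvi]
  · simp [Nat.testBit_xor, hmax j hj]

/-- Moving along `(v, w)` changes the XOR by `g v ^^^ g w`, whether or not tokens annihilate. -/
theorem xorSum_of_move {S T : Finset V} {v w : V} (hv : v ∈ S) (hne : w ≠ v)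
    (hT : (w ∉ S ∧ T = insert w (S.erase v)) ∨ (w ∈ S ∧ T = (S.erase v).erase w)) :
    xorSum g T = g w ^^^ (g v ^^^ xorSum g S) := by
  rcases hT with ⟨hw, rfl⟩ | ⟨hw, rfl⟩
  · rw [xorSum_insert g (fun h => hw (Finset.mem_of_mem_erase h)), xorSum_erase g hv]
  · rw [xorSum_erase g (Finset.mem_erase.2 ⟨hne, hw⟩), xorSum_erase g hv]

end XorSum

theorem AnnMove.sum_lt {V : Type*} [DecidableEq V] {E : V → V → Prop} {r : V → ℕ}
    (hr : ∀ v w, E v w → r w < r v) {S T : Finset V} (h : AnnMove E S T) :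
    ∑ x ∈ T, r x < ∑ x ∈ S, r x := by
  obtain ⟨v, hv, w, hE, hT⟩ := h
  have hlt := hr v w hE
  have hS := Finset.add_sum_erase S r hv
  rcases hT with ⟨hw, rfl⟩ | ⟨-, rfl⟩
  · rw [Finset.sum_insert (fun h => hw (Finset.mem_of_mem_erase h))]
    omega
  · have hle : ∑ x ∈ (S.erase v).erase w, r x ≤ ∑ x ∈ S.erase v, r x :=
      Finset.sum_le_sum_of_subset (Finset.erase_subset _ _)
    omega

theorem exists_rank_of_acyclic {V : Type*} [Finite V] {E : V → V → Prop}
    (hacyc : ∀ v, ¬ Relation.TransGen E v v) : ∃ r : V → ℕ, ∀ v w, E v w → r w < r v := by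
  refine ⟨fun v => {x | Relation.TransGen E v x}.ncard, fun v w h => ?_⟩
  refine Set.ncard_lt_ncard ⟨fun x hx => .head h hx, fun hsub => ?_⟩
  exact hacyc w (hsub (Relation.TransGen.single h))

/-- In the annihilation game on a finite acyclic digraph with Sprague–Grundy function
`g`, a position `S` is a P-position iff the XOR of `g v` over `v ∈ S` is `0`:
annihilation does not change the classical winning criterion on acyclic digraphs. -/
theorem annihilation_P_positions {V : Type*} [Fintype V] [DecidableEq V]
    (E : V → V → Prop) (hacyc : ∀ v, ¬ Relation.TransGen E v v)
    (g : V → ℕ) (hg : ∀ u, g u = mex (g '' {v | E u v}))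
    (P : Finset V → Prop)
    (hP : ∀ S, P S ↔ ∀ T, AnnMove E S T → ¬ P T) :
    ∀ S : Finset V, P S ↔ S.fold (fun a b : ℕ => a ^^^ b) 0 g = 0 := by
  obtain ⟨r, hr⟩ := exists_rank_of_acyclic hacyc
  have hne : ∀ v w, E v w → w ≠ v := fun v w h hwv => (hr v w h).ne (hwv ▸ rfl)
  have hgne : ∀ v w, E v w → g v ≠ g w := fun v w h hvw =>
    mex_notMem (Set.toFinite (g '' {x | E v x})) ((hg v) ▸ ⟨w, h, hvw.symm⟩)
  change ∀ S, P S ↔ xorSum g S = 0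
  intro S
  induction hn : ∑ x ∈ S, r x using Nat.strong_induction_on generalizing S with
  | _ n ih =>
    subst hn
    rw [hP]
    constructor
    · intro h
      by_contra h0
      obtain ⟨v, hv, hlt⟩ := exists_xor_xorSum_lt g h0
      obtain ⟨w, hE, hw⟩ := mem_of_lt_mex (hlt.trans_eq (hg v))
      obtain ⟨T, hT⟩ : ∃ T, (w ∉ S ∧ T = insert w (S.erase v)) ∨
          (w ∈ S ∧ T = (S.erase v).erase w) := by
        by_cases hwS : w ∈ S
        · exact ⟨_, .inr ⟨hwS, rfl⟩⟩
        · exact ⟨_, .inl ⟨hwS, rfl⟩⟩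
      have hmove : AnnMove E S T := ⟨v, hv, w, hE, hT⟩
      refine h T hmove ((ih _ (hmove.sum_lt hr) T rfl).2 ?_)
      rw [xorSum_of_move g hv (hne v w hE) hT, hw, Nat.xor_self]
    · intro h0 T hmove hPT
      have hT0 := (ih _ (hmove.sum_lt hr) T rfl).1 hPT
      obtain ⟨v, hv, w, hE, hT⟩ := hmove
      rw [xorSum_of_move g hv (hne v w hE) hT, h0, Nat.xor_zero, Nat.xor_eq_zero_iff] at hT0
      exact hgne v w hE hT0.symm
end

section
/- For Cyclic Nimhoff with parameter h, the Sprague–Grundy value of the position (a₁,…,a_n) equals h·(⌊a₁/h⌋ ⊕ ⌊a₂/h⌋ ⊕ … ⊕ ⌊a_n/h⌋) + ((a₁ + … + a_n) mod h), where ⊕ is bitwise XOR. -/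
/-- A move in Cyclic Nimhoff with parameter `h`: either remove a positive number of
tokens from a single pile, or remove `c i ≥ 0` tokens from each pile `i`
simultaneously, subject to `0 < ∑ c i < h`. -/
def CyclicNimhoffMove (h : ℕ) {n : ℕ} (a b : Fin n → ℕ) : Prop :=
  (∃ j m, 1 ≤ m ∧ m ≤ a j ∧ b = Function.update a j (a j - m)) ∨
  (∃ c : Fin n → ℕ, (∀ i, c i ≤ a i) ∧ 0 < ∑ i, c i ∧ ∑ i, c i < h ∧
    b = fun i => a i - c i)

theorem mex_eq_of_forall {S : Set ℕ} {v : ℕ} (hv : v ∉ S) (hlt : ∀ u < v, u ∈ S) :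
    mex S = v :=
  le_antisymm (Nat.sInf_le hv) <| le_csInf ⟨v, hv⟩ fun u hu => by
    by_contra! huv
    exact hu (hlt u huv)

/-- The bitwise XOR of a finite family of natural numbers. -/
def nimSum {n : ℕ} (f : Fin n → ℕ) : ℕ := (List.ofFn f).foldr (· ^^^ ·) 0

theorem nimSum_succ {n : ℕ} (f : Fin (n + 1) → ℕ) :
    nimSum f = f 0 ^^^ nimSum fun i => f i.succ := by
  simp [nimSum, List.ofFn_succ]

theorem nimSum_update {n : ℕ} (f : Fin n → ℕ) (j : Fin n) (x : ℕ) :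
    nimSum (Function.update f j x) = nimSum f ^^^ f j ^^^ x := by
  induction n with
  | zero => exact j.elim0
  | succ n ih =>
    rw [nimSum_succ, nimSum_succ]
    cases j using Fin.cases with
    | zero =>
      simp only [Function.update_self, ne_eq, Fin.succ_ne_zero, not_false_eq_true,
        Function.update_of_ne]
      rw [Nat.xor_comm (f 0), Nat.xor_assoc _ (f 0) (f 0), Nat.xor_self, Nat.xor_zero,
        Nat.xor_comm]
    | succ k =>
      have htail : (fun i : Fin n => Function.update f k.succ x i.succ) =
          Function.update (fun i => f i.succ) k x := by
        ext i
        simp [Function.update_apply]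
      rw [htail, ih, Function.update_of_ne (Fin.succ_ne_zero k).symm]
      simp only [Nat.xor_assoc]

theorem exists_xor_lt_of_lt_nimSum {n : ℕ} (f : Fin n → ℕ) {q : ℕ} (hq : q < nimSum f) :
    ∃ j, nimSum f ^^^ f j ^^^ q < f j := by
  induction n generalizing q with
  | zero => simp [nimSum] at hq
  | succ n ih =>
    rw [nimSum_succ] at hq ⊢
    rcases Nat.lt_xor_cases hq with h0 | hs
    · refine ⟨0, ?_⟩
      rwa [Nat.xor_comm (f 0), Nat.xor_assoc _ (f 0) (f 0), Nat.xor_self, Nat.xor_zero,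
        Nat.xor_comm]
    · obtain ⟨j, hj⟩ := ih _ hs
      refine ⟨j.succ, ?_⟩
      convert hj using 1
      ac_rfl

theorem exists_le_sum_eq {ι : Type*} [Fintype ι] (r : ι → ℕ) {d : ℕ} (hd : d ≤ ∑ i, r i) :
    ∃ c : ι → ℕ, (∀ i, c i ≤ r i) ∧ ∑ i, c i = d := by
  classical
  induction d with
  | zero => exact ⟨0, by simp⟩
  | succ d ih =>
    obtain ⟨c, hc, hsum⟩ := ih (by omega)
    obtain ⟨i, -, hi⟩ := Finset.exists_lt_of_sum_lt (s := Finset.univ) (f := c) (g := r)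
      (by omega)
    refine ⟨c + Pi.single i 1, fun k => ?_, by simp [Finset.sum_add_distrib, hsum]⟩
    rcases eq_or_ne k i with rfl | hk
    · simpa using hi
    · simpa [hk] using hc k

theorem sum_tsub_add_sum {ι : Type*} [Fintype ι] {a c : ι → ℕ} (hc : ∀ i, c i ≤ a i) :
    ∑ i, (a i - c i) + ∑ i, c i = ∑ i, a i := by
  rw [← Finset.sum_add_distrib]
  exact Finset.sum_congr rfl fun i _ => Nat.sub_add_cancel (hc i)

theorem sum_update_tsub_add {ι : Type*} [Fintype ι] [DecidableEq ι] {a : ι → ℕ} {j : ι} {m : ℕ}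
    (hm : m ≤ a j) : ∑ i, Function.update a j (a j - m) i + m = ∑ i, a i := by
  rw [Finset.sum_update_of_mem (Finset.mem_univ j),
    add_right_comm, Nat.sub_add_cancel hm,
    ← Finset.sum_eq_add_sum_sdiff_singleton_of_mem (Finset.mem_univ j)]

theorem nimSum_update_div {n : ℕ} (h : ℕ) (a : Fin n → ℕ) (j : Fin n) (x : ℕ) :
    nimSum (fun i => Function.update a j x i / h) =
      nimSum (fun i => a i / h) ^^^ a j / h ^^^ x / h := by
  rw [← nimSum_update (fun i => a i / h)]
  congr 1
  ext i
  simp only [Function.update_apply]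
  split_ifs <;> rfl

theorem CyclicNimhoffMove.sum_lt {h n : ℕ} {a b : Fin n → ℕ} (hab : CyclicNimhoffMove h a b) :
    ∑ i, b i < ∑ i, a i := by
  rcases hab with ⟨j, m, hm, hma, rfl⟩ | ⟨c, hca, hc, -, rfl⟩
  · have := sum_update_tsub_add hma
    omega
  · have := sum_tsub_add_sum hca
    dsimp only
    omega

theorem dvd_of_mod_eq_add_mod {h s d : ℕ} (hs : s % h = (s + d) % h) : h ∣ d :=
  Nat.modEq_zero_iff_dvd.1 <|
    Nat.ModEq.add_left_cancel' s (show s + d ≡ s + 0 [MOD h] from hs.symm)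

/-- The closed form for the Sprague–Grundy value of a Cyclic Nimhoff position. -/
def nimhoffValue (h : ℕ) {n : ℕ} (a : Fin n → ℕ) : ℕ :=
  h * nimSum (fun i => a i / h) + (∑ i, a i) % h

theorem nimhoffValue_div {h : ℕ} (hh : 0 < h) {n : ℕ} (a : Fin n → ℕ) :
    nimhoffValue h a / h = nimSum fun i => a i / h := by
  rw [nimhoffValue, Nat.mul_add_div hh, Nat.div_eq_of_lt (Nat.mod_lt _ hh), add_zero]

theorem nimhoffValue_mod (h : ℕ) {n : ℕ} (a : Fin n → ℕ) :
    nimhoffValue h a % h = (∑ i, a i) % h := by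
  rw [nimhoffValue, Nat.mul_add_mod, Nat.mod_mod]

theorem CyclicNimhoffMove.nimhoffValue_ne {h n : ℕ} (hh : 0 < h) {a b : Fin n → ℕ}
    (hab : CyclicNimhoffMove h a b) : nimhoffValue h b ≠ nimhoffValue h a := by
  intro heq
  have hmod := congrArg (· % h) heq
  simp only [nimhoffValue_mod] at hmod
  rcases hab with ⟨j, m, hm, hma, rfl⟩ | ⟨c, hca, hc, hch, rfl⟩
  · rw [← sum_update_tsub_add hma] at hmod
    have hdvd := dvd_of_mod_eq_add_mod hmod
    have hdiv := congrArg (· / h) heq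
    simp only [nimhoffValue_div hh, nimSum_update_div, Nat.xor_assoc] at hdiv
    have hquot : a j / h = (a j - m) / h := by
      rw [← Nat.xor_eq_zero_iff]
      exact Nat.xor_right_injective (hdiv.trans (Nat.xor_zero _).symm)
    obtain ⟨k, rfl⟩ := hdvd
    have hk : 0 < k := Nat.pos_of_mul_pos_left hm
    rw [Nat.sub_mul_div] at hquot
    have := (Nat.le_div_iff_mul_le hh).2 (by rwa [mul_comm] : k * h ≤ a j)
    omega
  · rw [← sum_tsub_add_sum hca] at hmod
    exact absurd (Nat.le_of_dvd hc (dvd_of_mod_eq_add_mod hmod)) (by omega)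

theorem exists_move_of_lt_mod {h n : ℕ} (hh : 0 < h) (a : Fin n → ℕ) {r : ℕ}
    (hr : r < (∑ i, a i) % h) :
    ∃ b, CyclicNimhoffMove h a b ∧
      nimSum (fun i => b i / h) = nimSum (fun i => a i / h) ∧ (∑ i, b i) % h = r := by
  have hS := Nat.mod_lt (∑ i, a i) hh
  have hle : (∑ i, a i) % h ≤ ∑ i, a i % h := by
    rw [Finset.sum_nat_mod]
    exact Nat.mod_le _ _
  obtain ⟨c, hc, hsum⟩ := exists_le_sum_eq (fun i => a i % h)
    (d := (∑ i, a i) % h - r) (by omega)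
  have hca : ∀ i, c i ≤ a i := fun i => (hc i).trans (Nat.mod_le _ _)
  refine ⟨fun i => a i - c i, Or.inr ⟨c, hca, by omega, by omega, rfl⟩, ?_, ?_⟩
  · congr 1
    ext i
    have hi := Nat.div_add_mod (a i) h
    have hlt := Nat.mod_lt (a i) hh
    have hci : c i ≤ a i % h := hc i
    dsimp only
    rw [show a i - c i = h * (a i / h) + (a i % h - c i) by omega, Nat.mul_add_div hh,
      Nat.div_eq_of_lt (by omega : a i % h - c i < h), add_zero]
  · have htot := sum_tsub_add_sum hca
    have hi := Nat.div_add_mod (∑ i, a i) h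
    rw [show ∑ i, (a i - c i) = h * ((∑ i, a i) / h) + r by omega, Nat.mul_add_mod,
      Nat.mod_eq_of_lt (by omega)]

theorem exists_move_of_lt_nimSum {h n : ℕ} (hh : 0 < h) (a : Fin n → ℕ) {q r : ℕ}
    (hq : q < nimSum fun i => a i / h) (hr : r < h) :
    ∃ b, CyclicNimhoffMove h a b ∧
      nimSum (fun i => b i / h) = q ∧ (∑ i, b i) % h = r := by
  obtain ⟨j, hj⟩ := exists_xor_lt_of_lt_nimSum _ hq
  set q' := nimSum (fun i => a i / h) ^^^ a j / h ^^^ q with hq'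
  set s := ∑ i ∈ Finset.univ \ {j}, a i
  set t := (r + (h - s % h)) % h
  have ht : t < h := Nat.mod_lt _ hh
  have hdiv : (h * q' + t) / h = q' := by
    rw [Nat.mul_add_div hh, Nat.div_eq_of_lt ht, add_zero]
  have hlt : h * q' + t < a j := by
    by_contra! hle
    have := Nat.div_le_div_right (c := h) hle
    omega
  refine ⟨Function.update a j (h * q' + t), Or.inl ⟨j, a j - (h * q' + t), by omega, by omega,
    by rw [Nat.sub_sub_self hlt.le]⟩, ?_, ?_⟩
  · rw [nimSum_update_div, hdiv, hq', ← Nat.xor_assoc, Nat.xor_self, Nat.zero_xor]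
  · rw [Finset.sum_update_of_mem (Finset.mem_univ j), add_assoc, Nat.mul_add_mod]
    have hs := Nat.div_add_mod s h
    have hs' := Nat.mod_lt s hh
    rw [Nat.mod_add_mod, show r + (h - s % h) + s = r + h * (s / h + 1) by
      rw [mul_add, mul_one]; omega, Nat.add_mul_mod_self_left, Nat.mod_eq_of_lt hr]

theorem exists_move_nimhoffValue_eq {h n : ℕ} (hh : 0 < h) (a : Fin n → ℕ) {v : ℕ}
    (hv : v < nimhoffValue h a) : ∃ b, CyclicNimhoffMove h a b ∧ nimhoffValue h b = v := by
  have hvdm := Nat.div_add_mod v h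
  have hle : v / h ≤ nimSum fun i => a i / h := by
    rw [← nimhoffValue_div hh]
    exact Nat.div_le_div_right hv.le
  have hmove : ∃ b, CyclicNimhoffMove h a b ∧
      nimSum (fun i => b i / h) = v / h ∧ (∑ i, b i) % h = v % h := by
    rcases hle.lt_or_eq with hlt | heq
    · exact exists_move_of_lt_nimSum hh a hlt (Nat.mod_lt v hh)
    · rw [heq]
      refine exists_move_of_lt_mod hh a ?_
      rw [← hvdm, nimhoffValue, heq] at hv
      exact lt_of_add_lt_add_left hv
  obtain ⟨b, hab, hdiv, hmod⟩ := hmove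
  exact ⟨b, hab, by rw [nimhoffValue, hdiv, hmod, hvdm]⟩

/-- The Sprague–Grundy value of the Cyclic Nimhoff position `(a₁,…,a_n)` is
`h·(⌊a₁/h⌋ ⊕ ⋯ ⊕ ⌊a_n/h⌋) + ((a₁ + ⋯ + a_n) mod h)`. -/
theorem cyclicNimhoff_grundy (h n : ℕ) (hh : 0 < h) (hn : 0 < n)
    (G : (Fin n → ℕ) → ℕ)
    (hG : ∀ a, G a = mex (G '' {b | CyclicNimhoffMove h a b})) :
    ∀ a : Fin n → ℕ,
      G a = h * (List.ofFn fun i => a i / h).foldr (· ^^^ ·) 0 + (∑ i, a i) % h := by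
  intro a
  change G a = nimhoffValue h a
  induction hs : ∑ i, a i using Nat.strong_induction_on generalizing a with
  | _ s ih =>
    subst hs
    rw [hG]
    refine mex_eq_of_forall ?_ fun v hv => ?_
    · rintro ⟨b, hab, hb⟩
      exact hab.nimhoffValue_ne hh ((ih _ hab.sum_lt b rfl).symm.trans hb)
    · obtain ⟨b, hab, hb⟩ := exists_move_nimhoffValue_eq hh a hv
      exact ⟨b, hab, (ih _ hab.sum_lt b rfl).trans hb⟩
end

section
/- The k-Nim-sum operation ⓚ is associative on the natural numbers: for all a, b, c ∈ ℕ, (a ⓚ b) ⓚ c = a ⓚ (b ⓚ c). -/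
/-- The `k`-Nim-sum: `a ⊕ b` if the `k`-th bits of `a` and `b` are not both `1`,
and `a ⊕ b` with its least significant bit complemented if they are both `1`. -/
def knimsum (k a b : ℕ) : ℕ :=
  if a.testBit k ∧ b.testBit k then (a ^^^ b) ^^^ 1 else a ^^^ b

theorem testBit_knimsum (k a b i : ℕ) :
    (knimsum k a b).testBit i =
      ((a.testBit i ^^ b.testBit i) ^^ (decide (i = 0) && (a.testBit k && b.testBit k))) := by
  unfold knimsum
  split_ifs with h
  · have : Nat.testBit 1 i = decide (i = 0) := by
      rw [Bool.eq_iff_iff, Nat.testBit_one_eq_true_iff_self_eq_zero, decide_eq_true_iff]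
    simp [h, this]
  · have : (a.testBit k && b.testBit k) = false := by simpa using h
    simp [this]

/-- The `k`-Nim-sum is associative on the natural numbers. -/
theorem knimsum_assoc (k : ℕ) (a b c : ℕ) :
    knimsum k (knimsum k a b) c = knimsum k a (knimsum k b c) := by
  refine Nat.eq_of_testBit_eq fun i => ?_
  simp only [testBit_knimsum]
  by_cases hi : i = 0
  · subst hi
    by_cases hk : k = 0
    · subst hk
      cases a.testBit 0 <;> cases b.testBit 0 <;> cases c.testBit 0 <;> rfl
    · simp only [hk, decide_true, decide_false, Bool.true_and, Bool.false_and, Bool.xor_false]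
      cases a.testBit k <;> cases b.testBit k <;> cases c.testBit k <;>
        cases a.testBit 0 <;> cases b.testBit 0 <;> cases c.testBit 0 <;> rfl
  · simp [hi]
end

section
/- For every k ∈ ℤ⁺, the two-pile game (k, k+1)-Nimdi is a Nimdi game: the Sprague–Grundy value of every position (a, b) equals the Nim-sum a ⊕ b, exactly as in two-pile Nim. -/
/-- A move in `(k, k+1)`-Nimdi: remove a positive number of tokens from a single
pile, or remove `k` tokens from one pile and `k+1` tokens from the other. -/
def NimdiMove (k : ℕ) (p q : ℕ × ℕ) : Prop :=
  (∃ i, 0 < i ∧ i ≤ p.1 ∧ q = (p.1 - i, p.2)) ∨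
  (∃ i, 0 < i ∧ i ≤ p.2 ∧ q = (p.1, p.2 - i)) ∨
  (k ≤ p.1 ∧ k + 1 ≤ p.2 ∧ q = (p.1 - k, p.2 - (k + 1))) ∨
  (k + 1 ≤ p.1 ∧ k ≤ p.2 ∧ q = (p.1 - (k + 1), p.2 - k))

theorem mex_eq {S : Set ℕ} {n : ℕ} (hn : n ∉ S) (hlt : ∀ m < n, m ∈ S) : mex S = n := by
  refine le_antisymm (Nat.sInf_le hn) (le_csInf ⟨n, hn⟩ fun m hm => ?_)
  by_contra! h
  exact hm (hlt m h)

theorem NimdiMove.add_lt {k : ℕ} {p q : ℕ × ℕ} (h : NimdiMove k p q) :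
    q.1 + q.2 < p.1 + p.2 := by
  rcases h with ⟨i, h0, h1, rfl⟩ | ⟨i, h0, h1, rfl⟩ | ⟨h0, h1, rfl⟩ | ⟨h0, h1, rfl⟩ <;>
    dsimp only <;> omega

theorem Nat.xor_mod_two_eq_add_mod_two (a b : ℕ) : (a ^^^ b) % 2 = (a + b) % 2 := by
  have h := Nat.xor_mod_two_pow (a := a) (b := b) (n := 1)
  rw [pow_one] at h
  rw [h, Nat.add_mod]
  rcases Nat.mod_two_eq_zero_or_one a with ha | ha <;>
    rcases Nat.mod_two_eq_zero_or_one b with hb | hb <;> simp [ha, hb]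

/-- No move preserves the Nim-sum: a move in a single pile by cancellation, and a move in both
piles because it removes an odd number of tokens, so changes the parity of the Nim-sum. -/
theorem NimdiMove.xor_ne {k : ℕ} {p q : ℕ × ℕ} (h : NimdiMove k p q) :
    q.1 ^^^ q.2 ≠ p.1 ^^^ p.2 := by
  intro he
  have hpar := congrArg (· % 2) he
  simp only [Nat.xor_mod_two_eq_add_mod_two] at hpar
  rcases h with ⟨i, h0, h1, rfl⟩ | ⟨i, h0, h1, rfl⟩ | ⟨h0, h1, rfl⟩ | ⟨h0, h1, rfl⟩
  · have := Nat.xor_left_injective he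
    omega
  · have := Nat.xor_right_injective he
    omega
  all_goals
    dsimp only at hpar
    omega

theorem NimdiMove.exists_xor_eq {k m : ℕ} {p : ℕ × ℕ} (hm : m < p.1 ^^^ p.2) :
    ∃ q, NimdiMove k p q ∧ q.1 ^^^ q.2 = m := by
  rcases Nat.lt_xor_cases hm with h | h
  · refine ⟨(m ^^^ p.2, p.2), Or.inl ⟨p.1 - (m ^^^ p.2), by omega, by omega, ?_⟩, ?_⟩
    · rw [Nat.sub_sub_self h.le]
    · exact Nat.xor_xor_cancel_right _ _
  · refine ⟨(p.1, m ^^^ p.1), Or.inr (Or.inl ⟨p.2 - (m ^^^ p.1), by omega, by omega, ?_⟩), ?_⟩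
    · rw [Nat.sub_sub_self h.le]
    · rw [Nat.xor_comm m, Nat.xor_xor_cancel_left]

/-- For every `k ≥ 1`, `(k, k+1)`-Nimdi is Nim in disguise: the Sprague–Grundy
value of every position `(a, b)` is the Nim-sum `a ⊕ b`. -/
theorem nimdi_grundy (k : ℕ) (hk : 0 < k)
    (G : ℕ × ℕ → ℕ) (hG : ∀ p, G p = mex (G '' {q | NimdiMove k p q})) :
    ∀ p : ℕ × ℕ, G p = p.1 ^^^ p.2 := by
  intro p
  induction hn : p.1 + p.2 using Nat.strong_induction_on generalizing p with
  | _ n ih =>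
    subst hn
    have hG' : ∀ q, NimdiMove k p q → G q = q.1 ^^^ q.2 := fun q hq => ih _ hq.add_lt q rfl
    rw [hG p]
    apply mex_eq
    · rintro ⟨q, hq, he⟩
      exact hq.xor_ne ((hG' q hq).symm.trans he)
    · intro m hm
      obtain ⟨q, hq, he⟩ := NimdiMove.exists_xor_eq (k := k) hm
      exact ⟨q, hq, (hG' q hq).trans he⟩
end

section
/- In the game Nimania starting from the single number n, the first player has a winning strategy for every n ≥ 1. -/
/-- A move in Nimania from position `(M, k)` (multiset `M` at stage `k`): select a
copy of some `m ∈ M`; if `m = 1` delete it, and if `m > 1` replace it by `k + 1`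
copies of `m - 1`; the stage then increases to `k + 1`. -/
def NimaniaMove (p q : Multiset ℕ × ℕ) : Prop :=
  ∃ m ∈ p.1,
    (m = 1 ∧ q = (p.1.erase 1, p.2 + 1)) ∨
    (1 < m ∧ q = (p.1.erase m + Multiset.replicate (p.2 + 1) (m - 1), p.2 + 1))

theorem NimaniaMove.isDershowitzMannaLT {p q : Multiset ℕ × ℕ} (h : NimaniaMove p q) :
    Multiset.IsDershowitzMannaLT q.1 p.1 := by
  obtain ⟨m, hm, ⟨rfl, rfl⟩ | ⟨hm1, rfl⟩⟩ := h
  · refine ⟨p.1.erase 1, 0, {1}, by simp, by simp, ?_, by simp⟩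
    rw [add_comm, Multiset.singleton_add, Multiset.cons_erase hm]
  · refine ⟨p.1.erase m, Multiset.replicate (p.2 + 1) (m - 1), {m}, by simp, rfl, ?_, ?_⟩
    · rw [add_comm, Multiset.singleton_add, Multiset.cons_erase hm]
    · intro y hy
      rw [Multiset.eq_of_mem_replicate hy]
      exact ⟨m, by simp, by omega⟩

theorem NimaniaMove.odd_count_one_or_exists_two_le {p q : Multiset ℕ × ℕ}
    (h : NimaniaMove p q) (hk : Even p.2) (hc : Even (p.1.count 1)) :
    Odd (q.1.count 1) ∨ ∃ m ∈ q.1, 2 ≤ m := by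
  obtain ⟨m, hm, ⟨rfl, rfl⟩ | ⟨hm1, rfl⟩⟩ := h
  · left
    have := Multiset.count_pos.2 hm
    rw [Multiset.count_erase_self]
    grind
  · obtain rfl | hm2 : m = 2 ∨ 3 ≤ m := by omega
    · left
      rw [Multiset.count_add, Multiset.count_erase_of_ne (by decide), Multiset.count_replicate]
      grind
    · right
      refine ⟨m - 1, Multiset.mem_add.2 (Or.inr ?_), by omega⟩
      simp [Multiset.mem_replicate]

theorem exists_nimaniaMove_even_count_one {p : Multiset ℕ × ℕ} (hk : Odd p.2)
    (h : Odd (p.1.count 1) ∨ ∃ m ∈ p.1, 2 ≤ m) :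
    ∃ q, NimaniaMove p q ∧ q.2 = p.2 + 1 ∧ Even (q.1.count 1) := by
  by_cases hc : Odd (p.1.count 1)
  · refine ⟨_, ⟨1, Multiset.count_pos.1 hc.pos, Or.inl ⟨rfl, rfl⟩⟩, rfl, ?_⟩
    rw [Multiset.count_erase_self]
    grind
  · obtain ⟨m, hm, hm2⟩ := h.resolve_left hc
    refine ⟨_, ⟨m, hm, Or.inr ⟨hm2, rfl⟩⟩, rfl, ?_⟩
    rw [Multiset.count_add, Multiset.count_erase_of_ne (by omega), Multiset.count_replicate]
    split_ifs <;> grind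

theorem NimaniaMove.snd_eq {p q : Multiset ℕ × ℕ} (h : NimaniaMove p q) : q.2 = p.2 + 1 := by
  obtain ⟨m, -, ⟨-, rfl⟩ | ⟨-, rfl⟩⟩ := h <;> rfl

/-- A position at an even stage with an even number of ones is lost for the player to move:
the opponent can restore this condition after every move. -/
theorem nimania_not_win_of_even {W : Multiset ℕ × ℕ → Prop}
    (hW : ∀ p, W p ↔ ∃ q, NimaniaMove p q ∧ ¬ W q) (p : Multiset ℕ × ℕ)
    (hk : Even p.2) (hc : Even (p.1.count 1)) : ¬ W p := by
  induction p using (InvImage.wf Prod.fst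
    (Multiset.wellFounded_isDershowitzMannaLT (α := ℕ))).induction with
  | _ p ih =>
    rw [hW]
    rintro ⟨q, hpq, hq⟩
    have hqk : Odd q.2 := hpq.snd_eq ▸ hk.add_one
    obtain ⟨r, hqr, hrk, hr⟩ := exists_nimaniaMove_even_count_one hqk
      (hpq.odd_count_one_or_exists_two_le hk hc)
    refine hq ((hW q).2 ⟨r, hqr, ih r ?_ (hrk ▸ hqk.add_one) hr⟩)
    exact hqr.isDershowitzMannaLT.trans hpq.isDershowitzMannaLT

/-- In Nimania, starting from the single number `n ≥ 1` at stage `1` (the player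
about to move wins iff some move leads to a position from which the opponent,
about to move, loses; the player facing the empty multiset loses), the first
player has a winning strategy. -/
theorem nimania_first_player_wins
    (W : Multiset ℕ × ℕ → Prop)
    (hW : ∀ p, W p ↔ ∃ q, NimaniaMove p q ∧ ¬ W q) :
    ∀ n : ℕ, 1 ≤ n → W ({n}, 1) := by
  intro n hn
  obtain ⟨q, hq, hqk, hqc⟩ := exists_nimaniaMove_even_count_one (p := ({n}, 1)) odd_one (by
    obtain rfl | hn2 : n = 1 ∨ 2 ≤ n := by omega
    · simp
    · exact Or.inr ⟨n, by simp, hn2⟩)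
  exact (hW _).2 ⟨q, hq, nimania_not_win_of_even hW q (by simp [hqk]) hqc⟩
end

section
/- In the game Nimania starting from the single number n with n ≥ 4, the second player (the loser) can force the play to last at least 2^(2^(n−2)) moves: the second player has a strategy such that every play of the game against it consists of at least 2^(2^(n−2)) moves. -/
/-- Bookkeeping along a play from `({n}, 1)`: `A v` counts the moves made so far on numbers `≥ v`.
Such moves happen at pairwise distinct stages, so they have produced at least
`A v * (A v + 3) / 2` numbers `≥ v - 1`. -/
def NimaniaInvariant (n : ℕ) (p : Multiset ℕ × ℕ) : Prop :=
  ∃ A : ℕ → ℕ, (∀ v, A v + 1 ≤ p.2) ∧ ∀ v, 1 ≤ v → v ≤ n →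
    2 + A (v + 1) * (A (v + 1) + 3) ≤ 2 * p.1.countP (v ≤ ·) + 2 * A v

theorem nimaniaInvariant_initial (n : ℕ) : NimaniaInvariant n ({n}, 1) := by
  refine ⟨fun _ => 0, fun _ => le_rfl, fun v _ hv => ?_⟩
  have : Multiset.countP (v ≤ ·) ({n} : Multiset ℕ) = 1 := by
    rw [← Multiset.cons_zero, Multiset.countP_cons_of_pos _ hv, Multiset.countP_zero]
  simp [this]

theorem NimaniaInvariant.move {n : ℕ} {p q : Multiset ℕ × ℕ} (h : NimaniaInvariant n p)
    (hpq : NimaniaMove p q) : NimaniaInvariant n q := by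
  obtain ⟨A, hA, hC⟩ := h
  obtain ⟨m, hm, hq⟩ := hpq
  have key : ∀ v, p.1.countP (v ≤ ·) = (p.1.erase m).countP (v ≤ ·) + if v ≤ m then 1 else 0 := by
    intro v
    conv_lhs => rw [← Multiset.cons_erase hm]
    rw [Multiset.countP_cons]
  refine ⟨fun v => A v + if v ≤ m then 1 else 0, fun v => ?_, fun v h1 hn => ?_⟩
  · have := hA v
    rcases hq with ⟨_, rfl⟩ | ⟨_, rfl⟩ <;> dsimp only <;> split_ifs <;> omega
  · have hv := hC v h1 hn
    have hA' := hA (v + 1)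
    rw [key v] at hv
    rcases hq with ⟨rfl, rfl⟩ | ⟨hm1, rfl⟩
    · have hlt : ¬ v + 1 ≤ 1 := by omega
      simp only [hlt, if_false, add_zero]
      split_ifs at hv ⊢ <;> omega
    · dsimp only
      rw [Multiset.countP_add]
      by_cases hlt : v + 1 ≤ m
      · have hrep : (Multiset.replicate (p.2 + 1) (m - 1)).countP (v ≤ ·) = p.2 + 1 := by
          rw [Multiset.countP_eq_card.2, Multiset.card_replicate]
          intro a ha
          rw [Multiset.eq_of_mem_replicate ha]
          omega
        have hvm : v ≤ m := by omega
        rw [hrep]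
        simp only [hlt, hvm, if_true] at hv ⊢
        nlinarith
      · simp only [hlt, if_false, add_zero]
        split_ifs at hv ⊢ <;> omega

theorem exists_nimaniaMove {p : Multiset ℕ × ℕ} {v : ℕ} (hv : 1 ≤ v)
    (h : 0 < p.1.countP (v ≤ ·)) : ∃ q, NimaniaMove p q := by
  obtain ⟨m, hm, hvm⟩ := Multiset.countP_pos.1 h
  rcases (hv.trans hvm).eq_or_lt with h1 | h1
  · exact ⟨_, m, hm, Or.inl ⟨h1.symm, rfl⟩⟩
  · exact ⟨_, m, hm, Or.inr ⟨h1, rfl⟩⟩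

/-- A position reached from `({n}, 1)` by fewer than `2 ^ 2 ^ (n - 2)` moves is not terminal. -/
theorem NimaniaInvariant.exists_move {n : ℕ} (hn : 4 ≤ n) {p : Multiset ℕ × ℕ}
    (h : NimaniaInvariant n p) (hp : p.2 ≤ 2 ^ 2 ^ (n - 2)) : ∃ q, NimaniaMove p q := by
  by_contra hstuck
  obtain ⟨A, hA, hC⟩ := h
  have hstep : ∀ v, 1 ≤ v → v ≤ n → 2 + A (v + 1) * (A (v + 1) + 3) ≤ 2 * A v := by
    intro v h1 h2
    have hzero : p.1.countP (v ≤ ·) = 0 := by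
      by_contra hne
      exact hstuck (exists_nimaniaMove h1 (Nat.pos_of_ne_zero hne))
    simpa [hzero] using hC v h1 h2
  have hgrow : ∀ i, i + 3 ≤ n → 2 * 2 ^ 2 ^ (i + 1) ≤ A (n - 2 - i) := by
    intro i
    induction i with
    | zero =>
      intro _
      have h0 := hstep n (by omega) le_rfl
      have h1 := hstep (n - 1) (by omega) (by omega)
      have h2 := hstep (n - 2) (by omega) (by omega)
      rw [show n - 1 + 1 = n by omega] at h1
      rw [show n - 2 + 1 = n - 1 by omega] at h2
      have h0' : 1 ≤ A n := by omega
      have h1' : 3 ≤ A (n - 1) := by nlinarith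
      norm_num
      nlinarith
    | succ i ih =>
      intro hi
      have hs := hstep (n - 2 - (i + 1)) (by omega) (by omega)
      rw [show n - 2 - (i + 1) + 1 = n - 2 - i by omega] at hs
      have ih' := ih (by omega)
      have hpow : 2 ^ 2 ^ (i + 1 + 1) = 2 ^ 2 ^ (i + 1) * 2 ^ 2 ^ (i + 1) := by
        rw [← pow_add, pow_succ 2 (i + 1), mul_two]
      rw [hpow]
      nlinarith [Nat.mul_le_mul ih' ih']
  have hlast := hgrow (n - 3) (by omega)
  rw [show n - 3 + 1 = n - 2 by omega] at hlast
  have := hA (n - 2 - (n - 3))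
  omega

/-- In Nimania starting from the single number `n ≥ 4`, the second player can force
the play to last at least `2^(2^(n-2))` moves.  Here `D1 p j` formalizes "with the
first player to move at `p`, the second player has a strategy forcing at least `j`
further moves to be played in total", and `D2 p j` the same with the second player
to move; the two hypotheses are the defining recurrences of these forcing
predicates (every play of Nimania is finite). -/
theorem nimania_loser_can_delay
    (D1 D2 : Multiset ℕ × ℕ → ℕ → Prop)
    (hD1 : ∀ p j, D1 p j ↔
      (j = 0 ∨ ((∃ q, NimaniaMove p q) ∧ ∀ q, NimaniaMove p q → D2 q (j - 1))))
    (hD2 : ∀ p j, D2 p j ↔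
      (j = 0 ∨ ∃ q, NimaniaMove p q ∧ D1 q (j - 1))) :
    ∀ n : ℕ, 4 ≤ n → D1 ({n}, 1) (2 ^ 2 ^ (n - 2)) := by
  intro n hn
  have forced : ∀ j p, NimaniaInvariant n p → p.2 + j ≤ 2 ^ 2 ^ (n - 2) + 1 →
      D1 p j ∧ D2 p j := by
    intro j
    induction j with
    | zero => exact fun p _ _ => ⟨(hD1 p 0).2 (Or.inl rfl), (hD2 p 0).2 (Or.inl rfl)⟩
    | succ j ih =>
      intro p hp hj
      have next : ∀ q, NimaniaMove p q → D1 q j ∧ D2 q j := by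
        intro q hq
        refine ih q (hp.move hq) ?_
        obtain ⟨m, _, ⟨_, rfl⟩ | ⟨_, rfl⟩⟩ := hq <;> dsimp only <;> omega
      obtain ⟨q, hq⟩ := hp.exists_move hn (by omega)
      exact ⟨(hD1 p _).2 (Or.inr ⟨⟨q, hq⟩, fun r hr => (next r hr).2⟩),
        (hD2 p _).2 (Or.inr ⟨q, hq, (next q hq).1⟩)⟩
  exact (forced _ _ (nimaniaInvariant_initial n) (by dsimp only; omega)).1
end

section
/- In the poset game on a finite nonempty partially ordered set that has a greatest element, the first player has a winning strategy (by strategy stealing). -/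
/-- A move in the poset game on `P`: from position `A`, select `x ∈ A` and remove
all elements `y ≥ x` (in particular `x` itself). -/
def PosetGameMove {P : Type*} [PartialOrder P] [DecidableEq P]
    [DecidableRel ((· ≤ ·) : P → P → Prop)] (A B : Finset P) : Prop :=
  ∃ x ∈ A, B = A.filter fun y => ¬ x ≤ y

/-- In the poset game on a finite nonempty partially ordered set with a greatest
element, played from the full poset (the player about to move wins iff some move
leads to a position from which the opponent, about to move, loses; the player
facing the empty position loses), the first player has a winning strategy. -/
theorem posetGame_first_player_wins {P : Type*} [Fintype P] [Nonempty P]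
    [PartialOrder P] [OrderTop P] [DecidableEq P]
    [DecidableRel ((· ≤ ·) : P → P → Prop)]
    (W : Finset P → Prop)
    (hW : ∀ A, W A ↔ ∃ B, PosetGameMove A B ∧ ¬ W B) :
    W Finset.univ := by
  by_cases h : W (Finset.univ.filter fun y : P => ¬ ⊤ ≤ y)
  · obtain ⟨B, ⟨x, -, rfl⟩, hB⟩ := (hW _).1 h
    refine (hW _).2 ⟨_, ⟨x, Finset.mem_univ x, ?_⟩, hB⟩
    ext y
    simp only [Finset.mem_filter, Finset.mem_univ, true_and, and_iff_right_iff_imp]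
    exact fun hxy hy => hxy (le_top.trans hy)
  · exact (hW _).2 ⟨_, ⟨⊤, Finset.mem_univ ⊤, rfl⟩, h⟩
end
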